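/- arXiv:1509.06568 — 6 statements merged into one kernel-verified Lean document; each statement's English description precedes it below -/
import Mathlib

section
/- Let u₁ < u₂ and v₁ < v₂ be real numbers, let f, g : [u₁,u₂] × [v₁,v₂] → ℝ be continuous and non-negative, let h : [u₁,u₂] → ℝ and k : [v₁,v₂] → ℝ be continuous and non-negative, and let A, B > 0 be constants. Suppose that for all (u,v) ∈ [u₁,u₂] × [v₁,v₂] one has f(u,v) + g(u,v) ≤ A + B·(∫_{u₁}^{u} h(u')·f(u',v) du' + ∫_{v₁}^{v} k(v')·g(u,v') dv'). Then for every η > 0 and every β ≥ 2(1+η)/η, one has f(u,v) + g(u,v) ≤ (1+η)·A·exp(β·B·(∫_{u₁}^{u} h(u') du' + ∫_{v₁}^{v} k(v') dv')) for all (u,v) ∈ [u₁,u₂] × [v₁,v₂]. -/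
open Filter Set Topology intervalIntegral

/-- A primitive of a continuous function is continuous on the interval. -/
theorem continuousOn_primitive_of_continuousOn {a b : ℝ} (hab : a ≤ b) {h : ℝ → ℝ}
    (hh : ContinuousOn h (Set.Icc a b)) :
    ContinuousOn (fun x => ∫ s in a..x, h s) (Set.Icc a b) := by
  have := intervalIntegral.continuousOn_primitive_interval'
    (hh.intervalIntegrable_of_Icc (μ := MeasureTheory.volume) hab)
    (Set.left_mem_uIcc (a := a) (b := b))
  rwa [Set.uIcc_of_le hab] at this

theorem integral_mul_exp_primitive {a x c : ℝ} (hax : a ≤ x) (hc : c ≠ 0) {h : ℝ → ℝ}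
    (hh : ContinuousOn h (Set.Icc a x)) :
    ∫ s in a..x, h s * Real.exp (c * ∫ t in a..s, h t) =
      (Real.exp (c * ∫ t in a..x, h t) - 1) / c := by
  have hP := continuousOn_primitive_of_continuousOn hax hh
  have hE : ContinuousOn (fun s => Real.exp (c * ∫ t in a..s, h t)) (Set.Icc a x) := by fun_prop
  rw [intervalIntegral.integral_eq_sub_of_hasDerivAt_of_le hax
    (f := fun s => Real.exp (c * ∫ t in a..s, h t) / c)
    (f' := fun s => h s * Real.exp (c * ∫ t in a..s, h t)) (hE.div_const c) ?_
    ((hh.mul hE).intervalIntegrable_of_Icc hax)]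
  · simp [sub_div]
  · intro s hs
    have hd : HasDerivAt (fun s => ∫ t in a..s, h t) (h s) s :=
      intervalIntegral.integral_hasDerivAt_right
        ((hh.mono (Set.Icc_subset_Icc_right hs.2.le)).intervalIntegrable_of_Icc hs.1.le)
        ((hh.mono Set.Ioo_subset_Icc_self).stronglyMeasurableAtFilter isOpen_Ioo s hs)
        (hh.continuousAt (Icc_mem_nhds hs.1 hs.2))
    refine ((hd.const_mul c).exp.div_const c).congr_deriv ?_
    field_simp

theorem integral_mul_le_of_le_exp_primitive {a x c C : ℝ} (hax : a ≤ x) (hc : 0 < c)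
    (hC : 0 ≤ C) {h φ : ℝ → ℝ} (hh : ContinuousOn h (Set.Icc a x))
    (hφ : ContinuousOn φ (Set.Icc a x)) (h_nonneg : ∀ s ∈ Set.Icc a x, 0 ≤ h s)
    (hle : ∀ s ∈ Set.Icc a x, φ s ≤ C * Real.exp (c * ∫ t in a..s, h t)) :
    ∫ s in a..x, h s * φ s ≤ C * Real.exp (c * ∫ t in a..x, h t) / c := by
  have hP := continuousOn_primitive_of_continuousOn hax hh
  have hE : ContinuousOn (fun s => Real.exp (c * ∫ t in a..s, h t)) (Set.Icc a x) := by fun_prop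
  calc ∫ s in a..x, h s * φ s
      ≤ ∫ s in a..x, C * (h s * Real.exp (c * ∫ t in a..s, h t)) := by
        refine intervalIntegral.integral_mono_on hax ((hh.mul hφ).intervalIntegrable_of_Icc hax)
          (((hh.mul hE).intervalIntegrable_of_Icc hax).const_mul C) fun s hs => ?_
        calc h s * φ s ≤ h s * (C * Real.exp (c * ∫ t in a..s, h t)) :=
              mul_le_mul_of_nonneg_left (hle s hs) (h_nonneg s hs)
          _ = _ := by ring
    _ = C * ((Real.exp (c * ∫ t in a..x, h t) - 1) / c) := by
        rw [intervalIntegral.integral_const_mul, integral_mul_exp_primitive hax hc.ne' hh]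
    _ ≤ C * (Real.exp (c * ∫ t in a..x, h t) / c) := by
        gcongr
        linarith
    _ = _ := by ring

/-- **Grönwall's inequality in two variables** (Lemma 4.1 of the paper):
if `f + g` satisfies a two-variable integral inequality on the rectangle
`[u₁,u₂] × [v₁,v₂]`, then it satisfies the corresponding exponential bound. -/
theorem gronwall_two_variables
    (u₁ u₂ v₁ v₂ : ℝ) (hu : u₁ < u₂) (hv : v₁ < v₂)
    (f g : ℝ → ℝ → ℝ) (h k : ℝ → ℝ)
    (hf_cont : ContinuousOn (fun p : ℝ × ℝ => f p.1 p.2) (Set.Icc u₁ u₂ ×ˢ Set.Icc v₁ v₂))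
    (hg_cont : ContinuousOn (fun p : ℝ × ℝ => g p.1 p.2) (Set.Icc u₁ u₂ ×ˢ Set.Icc v₁ v₂))
    (hf_nonneg : ∀ u ∈ Set.Icc u₁ u₂, ∀ v ∈ Set.Icc v₁ v₂, 0 ≤ f u v)
    (hg_nonneg : ∀ u ∈ Set.Icc u₁ u₂, ∀ v ∈ Set.Icc v₁ v₂, 0 ≤ g u v)
    (hh_cont : ContinuousOn h (Set.Icc u₁ u₂))
    (hk_cont : ContinuousOn k (Set.Icc v₁ v₂))
    (hh_nonneg : ∀ u ∈ Set.Icc u₁ u₂, 0 ≤ h u)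
    (hk_nonneg : ∀ v ∈ Set.Icc v₁ v₂, 0 ≤ k v)
    (A B : ℝ) (hA : 0 < A) (hB : 0 < B)
    (hmain : ∀ u ∈ Set.Icc u₁ u₂, ∀ v ∈ Set.Icc v₁ v₂,
      f u v + g u v ≤
        A + B * ((∫ u' in u₁..u, h u' * f u' v) + ∫ v' in v₁..v, k v' * g u v')) :
    ∀ η > (0:ℝ), ∀ β : ℝ, 2 * (1 + η) / η ≤ β →
      ∀ u ∈ Set.Icc u₁ u₂, ∀ v ∈ Set.Icc v₁ v₂,
        f u v + g u v ≤
          (1 + η) * A * Real.exp (β * B * ((∫ u' in u₁..u, h u') + ∫ v' in v₁..v, k v')) := by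
  intro η hη β hβ
  have hβ0 : 0 < β := lt_of_lt_of_le (by positivity) hβ
  have hc : 0 < β * B := mul_pos hβ0 hB
  have hH := continuousOn_primitive_of_continuousOn hu.le hh_cont
  have hK := continuousOn_primitive_of_continuousOn hv.le hk_cont
  set H : ℝ → ℝ := fun u => ∫ u' in u₁..u, h u'
  set K : ℝ → ℝ := fun v => ∫ v' in v₁..v, k v'
  set E : ℝ → ℝ → ℝ := fun u v => Real.exp (β * B * (H u + K v))
  have hE_pos : ∀ u v, 0 < E u v := fun u v => Real.exp_pos _
  have hE_cont : ContinuousOn (fun p : ℝ × ℝ => E p.1 p.2)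
      (Set.Icc u₁ u₂ ×ˢ Set.Icc v₁ v₂) := by
    have h1 : ContinuousOn (fun p : ℝ × ℝ => H p.1) (Set.Icc u₁ u₂ ×ˢ Set.Icc v₁ v₂) :=
      hH.comp continuousOn_fst fun p hp => hp.1
    have h2 : ContinuousOn (fun p : ℝ × ℝ => K p.2) (Set.Icc u₁ u₂ ×ˢ Set.Icc v₁ v₂) :=
      hK.comp continuousOn_snd fun p hp => hp.2
    exact ((h1.add h2).const_mul (β * B)).rexp
  obtain ⟨⟨a, b⟩, ⟨ha, hb⟩, hmax⟩ := (isCompact_Icc.prod isCompact_Icc).exists_isMaxOn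
    ((Set.nonempty_Icc.2 hu.le).prod (Set.nonempty_Icc.2 hv.le))
    ((hf_cont.add hg_cont).div hE_cont fun p _ => (hE_pos p.1 p.2).ne')
  set M := (f a b + g a b) / E a b
  have hM0 : 0 ≤ M :=
    div_nonneg (add_nonneg (hf_nonneg a ha b hb) (hg_nonneg a ha b hb)) (hE_pos a b).le
  have hle : ∀ u ∈ Set.Icc u₁ u₂, ∀ v ∈ Set.Icc v₁ v₂, f u v + g u v ≤ M * E u v :=
    fun u hu' v hv' => (div_le_iff₀ (hE_pos u v)).1 (hmax (Set.mk_mem_prod hu' hv'))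
  have hsplit : ∀ u v, E u v = Real.exp (β * B * H u) * Real.exp (β * B * K v) := fun u v => by
    rw [← Real.exp_add, ← mul_add]
  have ha' : Set.Icc u₁ a ⊆ Set.Icc u₁ u₂ := Set.Icc_subset_Icc_right ha.2
  have hb' : Set.Icc v₁ b ⊆ Set.Icc v₁ v₂ := Set.Icc_subset_Icc_right hb.2
  have hI : ∫ u' in u₁..a, h u' * f u' b ≤ M * E a b / (β * B) := by
    have := integral_mul_le_of_le_exp_primitive (C := M * Real.exp (β * B * K b))
      (φ := fun u => f u b) ha.1 hc (by positivity) (hh_cont.mono ha')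
      (hf_cont.comp (f := fun u => (u, b)) (by fun_prop)
        fun u hu' => Set.mk_mem_prod (ha' hu') hb)
      (fun s hs => hh_nonneg s (ha' hs)) fun s hs => ?_
    · refine this.trans_eq ?_
      rw [hsplit]
      ring
    · have h1 := hle s (ha' hs) b hb
      have h2 := hg_nonneg s (ha' hs) b hb
      rw [hsplit] at h1
      change f s b ≤ M * Real.exp (β * B * K b) * Real.exp (β * B * H s)
      linarith
  have hJ : ∫ v' in v₁..b, k v' * g a v' ≤ M * E a b / (β * B) := by
    have := integral_mul_le_of_le_exp_primitive (C := M * Real.exp (β * B * H a))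
      (φ := fun v => g a v) hb.1 hc (by positivity) (hk_cont.mono hb')
      (hg_cont.comp (f := fun v => (a, v)) (by fun_prop)
        fun v hv' => Set.mk_mem_prod ha (hb' hv'))
      (fun s hs => hk_nonneg s (hb' hs)) fun s hs => ?_
    · refine this.trans_eq ?_
      rw [hsplit]
      ring
    · have h1 := hle a ha s (hb' hs)
      have h2 := hf_nonneg a ha s (hb' hs)
      rw [hsplit] at h1
      change g a s ≤ M * Real.exp (β * B * H a) * Real.exp (β * B * K s)
      linarith
  have hH0 : 0 ≤ H a := intervalIntegral.integral_nonneg ha.1 fun s hs => hh_nonneg s (ha' hs)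
  have hK0 : 0 ≤ K b := intervalIntegral.integral_nonneg hb.1 fun s hs => hk_nonneg s (hb' hs)
  have hE1 : 1 ≤ E a b := Real.one_le_exp (by positivity)
  have hMA : M ≤ (1 + η) * A := by
    have h1 : M * E a b ≤ A + B * (M * E a b / (β * B) + M * E a b / (β * B)) := by
      calc M * E a b = f a b + g a b := div_mul_cancel₀ _ (hE_pos a b).ne'
        _ ≤ _ := hmain a ha b hb
        _ ≤ _ := by gcongr
    have h2 : B * (M * E a b / (β * B) + M * E a b / (β * B)) = M * E a b * (2 / β) := by
      field_simp
      ring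
    have h3 : 2 / β ≤ η / (1 + η) := by
      rw [div_le_iff₀ hη] at hβ
      rw [div_le_div_iff₀ hβ0 (by positivity)]
      linarith
    have h4 : M * E a b * (2 / β) ≤ M * E a b * (η / (1 + η)) := by gcongr
    have h5 : M * E a b * (η / (1 + η)) = M * E a b - M * E a b / (1 + η) := by
      field_simp
      ring
    have h6 : M * E a b / (1 + η) ≤ A := by linarith
    rw [div_le_iff₀ (by positivity)] at h6
    nlinarith [mul_le_mul_of_nonneg_left hE1 hM0]
  intro u hu' v hv'
  exact (hle u hu' v hv').trans (mul_le_mul_of_nonneg_right hMA (hE_pos u v).le)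
end

section
/- Fix M > 0 and let r_*⁻¹ : (M + 2M·log M, ∞) → (0,M) denote the inverse of the tortoise function. Then lim_{s→∞} s·(M − r_*⁻¹(s)) = M². -/
open Filter Set Topology

noncomputable section

/-- The extremal Reissner--Nordström tortoise function. -/
def rstar (M ρ : ℝ) : ℝ := M ^ 2 / (M - ρ) + 2 * M * Real.log (M - ρ) + ρ

/-- If `rinv` is the inverse of the tortoise function, defined on
`(M + 2M log M, ∞)`, then `s · (M - rinv s) → M²` as `s → ∞`. -/
theorem horizon_distance_limit (M : ℝ) (hM : 0 < M) (rinv : ℝ → ℝ)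
    (hinv : ∀ s : ℝ, M + 2 * M * Real.log M < s →
      rinv s ∈ Set.Ioo 0 M ∧ rstar M (rinv s) = s) :
    Tendsto (fun s => s * (M - rinv s)) atTop (𝓝 (M ^ 2)) := by
  have key : ∀ᶠ s in atTop, 0 < s ∧ 0 < M - rinv s ∧ M - rinv s < M ∧
      s * (M - rinv s) = M ^ 2 + 2 * M * ((M - rinv s) * Real.log (M - rinv s))
        + rinv s * (M - rinv s) := by
    filter_upwards [eventually_gt_atTop (M + 2 * M * Real.log M), eventually_gt_atTop 0]
      with s hs hs0
    obtain ⟨⟨h0, h1⟩, h2⟩ := hinv s hs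
    have hx : 0 < M - rinv s := sub_pos.2 h1
    refine ⟨hs0, hx, by linarith, ?_⟩
    rw [rstar] at h2
    nth_rewrite 1 [← h2]
    field_simp
  have hdist : Tendsto (fun s => M - rinv s) atTop (𝓝 0) := by
    refine squeeze_zero' (key.mono fun s hs => hs.2.1.le) ?_
      (tendsto_const_nhds.div_atTop tendsto_id :
        Tendsto (fun s : ℝ => (2 * M ^ 2 + 2 * M ^ 3) / s) atTop (𝓝 0))
    filter_upwards [key] with s ⟨hs, hx, hxM, h⟩
    rw [le_div_iff₀ hs, mul_comm, h]
    have hlog : Real.log (M - rinv s) ≤ M := by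
      linarith [Real.log_le_sub_one_of_pos hx]
    have hxlog : (M - rinv s) * Real.log (M - rinv s) ≤ M * M :=
      (mul_le_mul_of_nonneg_left hlog hx.le).trans (mul_le_mul_of_nonneg_right hxM.le hM.le)
    nlinarith [mul_le_mul_of_nonneg_left hxlog hM.le, sq_nonneg (rinv s - M / 2)]
  have hxlog : Tendsto (fun s => (M - rinv s) * Real.log (M - rinv s)) atTop (𝓝 0) := by
    simpa [Function.comp_def] using (Real.continuous_mul_log.tendsto 0).comp hdist
  have hrinv : Tendsto rinv atTop (𝓝 M) := by
    simpa using (tendsto_const_nhds (x := M)).sub hdist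
  have hlim := ((hxlog.const_mul (2 * M)).const_add (M ^ 2)).add (hrinv.mul hdist)
  simp only [mul_zero, add_zero] at hlim
  exact hlim.congr' (key.mono fun s hs => hs.2.2.2.symm)

end
end

section
/- Fix M > 0 and let r_*⁻¹ : (M + 2M·log M, ∞) → (0,M) denote the inverse of the tortoise function. Then lim_{s→∞} s²·(1 − M/r_*⁻¹(s))² = M². Equivalently, for the interior radius function r(u,v) := r_*⁻¹(v−u) and the conformal factor Ω²(u,v) := (1 − M/r(u,v))², one has (v−u)²·Ω²(u,v) → M² as v − u → ∞. -/
open Filter Set Topology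

noncomputable section

/-- An inverse of the tortoise function tends to the horizon radius `M`. -/
theorem tendsto_of_rstar_eq {M : ℝ} (hM : 0 < M) {rinv : ℝ → ℝ}
    (h : ∀ᶠ s in atTop, rinv s ∈ Set.Ioo 0 M ∧ rstar M (rinv s) = s) :
    Tendsto rinv atTop (𝓝 M) := by
  have hbound : ∀ᶠ s in atTop, M - (2 * M ^ 2 + 2 * M ^ 3) / s ≤ rinv s := by
    filter_upwards [h, eventually_gt_atTop 0] with s ⟨⟨h0, hlt⟩, hs⟩ hpos
    have hx : 0 < M - rinv s := sub_pos.2 hlt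
    have hlog : Real.log (M - rinv s) ≤ M := by
      linarith [Real.log_le_sub_one_of_pos hx]
    have hxs : (M - rinv s) * s =
        M ^ 2 + 2 * M * ((M - rinv s) * Real.log (M - rinv s)) + (M - rinv s) * rinv s := by
      nth_rewrite 2 [← hs]
      rw [rstar]
      field_simp
    have hxlog : (M - rinv s) * Real.log (M - rinv s) ≤ M * M :=
      (mul_le_mul_of_nonneg_left hlog hx.le).trans (by gcongr; linarith)
    have hxr : (M - rinv s) * rinv s ≤ M * M := by gcongr; linarith
    have : M - rinv s ≤ (2 * M ^ 2 + 2 * M ^ 3) / s := by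
      rw [le_div_iff₀ hpos, hxs]
      linarith [mul_le_mul_of_nonneg_left hxlog (by positivity : 0 ≤ 2 * M)]
    linarith
  have hlower : Tendsto (fun s : ℝ => M - (2 * M ^ 2 + 2 * M ^ 3) / s) atTop (𝓝 M) := by
    simpa using (tendsto_id.const_div_atTop (2 * M ^ 2 + 2 * M ^ 3)).const_sub M
  exact tendsto_of_tendsto_of_tendsto_of_le_of_le' hlower tendsto_const_nhds hbound
    (h.mono fun s hs => hs.1.2.le)

/-- If `rinv` is the inverse of the tortoise function, then
`s² (1 - M/rinv s)² → M²` as `s → ∞`; equivalently, for the interior radius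
`r(u,v) = rinv (v-u)` and conformal factor `Ω²(u,v) = (1 - M/r(u,v))²` one has
`(v-u)² Ω²(u,v) → M²` as `v - u → ∞`. -/
theorem conformal_factor_limit (M : ℝ) (hM : 0 < M) (rinv : ℝ → ℝ)
    (hinv : ∀ s : ℝ, M + 2 * M * Real.log M < s →
      rinv s ∈ Set.Ioo 0 M ∧ rstar M (rinv s) = s) :
    Tendsto (fun s => s ^ 2 * (1 - M / rinv s) ^ 2) atTop (𝓝 (M ^ 2)) ∧
    ∀ u : ℝ, Tendsto (fun v => (v - u) ^ 2 * (1 - M / rinv (v - u)) ^ 2)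
      atTop (𝓝 (M ^ 2)) := by
  have h : ∀ᶠ s in atTop, rinv s ∈ Set.Ioo 0 M ∧ rstar M (rinv s) = s :=
    (eventually_gt_atTop _).mono hinv
  have hr : Tendsto rinv atTop (𝓝 M) := tendsto_of_rstar_eq hM h
  have hcont : ContinuousAt (fun ρ : ℝ =>
      ((M ^ 2 + 2 * M * ((M - ρ) * Real.log (M - ρ)) + (M - ρ) * ρ) / ρ) ^ 2) M := by
    have hlog : Continuous fun ρ : ℝ => (M - ρ) * Real.log (M - ρ) :=
      Real.continuous_mul_log.comp (continuous_const.sub continuous_id)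
    have := hM.ne'
    fun_prop (disch := assumption)
  have hlim : Tendsto (fun s => s ^ 2 * (1 - M / rinv s) ^ 2) atTop (𝓝 (M ^ 2)) := by
    have hval : ((M ^ 2 + 2 * M * ((M - M) * Real.log (M - M)) + (M - M) * M) / M) ^ 2
        = M ^ 2 := by
      field_simp
      simp
    rw [← hval]
    refine (hcont.tendsto.comp hr).congr' ?_
    filter_upwards [h] with s ⟨⟨h0, hlt⟩, hs⟩
    have hx : M - rinv s ≠ 0 := (sub_pos.2 hlt).ne'
    have hxs : M ^ 2 + 2 * M * ((M - rinv s) * Real.log (M - rinv s)) + (M - rinv s) * rinv s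
        = (M - rinv s) * s := by
      nth_rewrite 6 [← hs]
      rw [rstar]
      field_simp
    simp only [Function.comp_apply, hxs]
    field_simp
    ring
  exact ⟨hlim, fun u => hlim.comp (tendsto_atTop_add_const_right atTop (-u) tendsto_id)⟩

end
end

section
/- Fix M > 0 and define r(u,v) := r_*⁻¹(v−u) and Ω²(u,v) := (1 − M/r(u,v))². Then for all fixed v₀ and v with v ≥ v₀ (and v₀ − u > M + 2M·log M for u considered): lim_{u→−∞} Ω²(u,v)/Ω²(u,v₀) = 1, and lim_{u→−∞} (v−u)·(1 − Ω²(u,v)/Ω²(u,v₀)) = 2(v − v₀). -/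
open Filter Set Topology

noncomputable section

/-- The conformal factor `Ω²(u,v) = (1 - M/r(u,v))²` with `r(u,v) = rinv (v-u)`. -/
def Om2 (M : ℝ) (rinv : ℝ → ℝ) (u v : ℝ) : ℝ := (1 - M / rinv (v - u)) ^ 2

section

variable {M : ℝ} {rinv : ℝ → ℝ}

theorem tendsto_horizon_gap
    (hinv : ∀ s : ℝ, M + 2 * M * Real.log M < s →
      rinv s ∈ Set.Ioo 0 M ∧ rstar M (rinv s) = s) :
    Tendsto (fun s => M - rinv s) atTop (𝓝 0) := by
  set c := M + 2 * M * Real.log M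
  have hbound : Tendsto (fun s : ℝ => M ^ 2 / (s - c)) atTop (𝓝 0) :=
    (tendsto_atTop_add_const_right _ (-c) tendsto_id).const_div_atTop _
  refine squeeze_zero' ?_ ?_ hbound
  · filter_upwards [eventually_gt_atTop c] with s hs
    linarith [(hinv s hs).1.2]
  · filter_upwards [eventually_gt_atTop c] with s hs
    obtain ⟨⟨hpos, hlt⟩, heq⟩ := hinv s hs
    have hgap : 0 < M - rinv s := by linarith
    have hlog : Real.log (M - rinv s) ≤ Real.log M := Real.log_le_log hgap (by linarith)
    have hlog' := mul_le_mul_of_nonneg_left hlog (by linarith : 0 ≤ 2 * M)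
    unfold rstar at heq
    rw [le_div_comm₀ hgap (by linarith)]
    linarith

theorem tendsto_mul_horizon_gap
    (hinv : ∀ s : ℝ, M + 2 * M * Real.log M < s →
      rinv s ∈ Set.Ioo 0 M ∧ rstar M (rinv s) = s) :
    Tendsto (fun s => s * (M - rinv s)) atTop (𝓝 (M ^ 2)) := by
  have hx := tendsto_horizon_gap hinv
  have hcont : Continuous fun x : ℝ => M ^ 2 + 2 * M * (x * Real.log x) + (M - x) * x :=
    (continuous_const.add (continuous_const.mul Real.continuous_mul_log)).add
      ((continuous_const.sub continuous_id).mul continuous_id)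
  have hlim := (hcont.tendsto 0).comp hx
  simp only [zero_mul, mul_zero, add_zero] at hlim
  refine hlim.congr' ?_
  filter_upwards [eventually_gt_atTop (M + 2 * M * Real.log M)] with s hs
  obtain ⟨⟨-, hlt⟩, heq⟩ := hinv s hs
  have hgap : M - rinv s ≠ 0 := by linarith
  simp only [Function.comp_apply]
  unfold rstar at heq
  generalize rinv s = ρ at *
  rw [← heq]
  field_simp
  ring

end

theorem abs_log_div_inv_sub_inv_le {a b : ℝ} (ha : 0 < a) (hb : 0 < b) :
    |(Real.log b - Real.log a) / (a⁻¹ - b⁻¹)| ≤ a + b := by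
  have hupper := Real.log_le_sub_one_of_pos (div_pos hb ha)
  have hlower := Real.log_le_sub_one_of_pos (div_pos ha hb)
  rw [Real.log_div hb.ne' ha.ne'] at hupper
  rw [Real.log_div ha.ne' hb.ne'] at hlower
  have h₁ : b / a - 1 = b * (a⁻¹ - b⁻¹) := by field_simp
  have h₂ : a / b - 1 = -(a * (a⁻¹ - b⁻¹)) := by field_simp; ring
  rw [h₁] at hupper
  rw [h₂] at hlower
  generalize a⁻¹ - b⁻¹ = D at *
  rcases eq_or_ne D 0 with rfl | hD
  · simpa using (add_pos ha hb).le
  rw [abs_div, div_le_iff₀ (abs_pos.2 hD), abs_le]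
  rcases abs_cases D with ⟨h, h'⟩ | ⟨h, h'⟩ <;> rw [h] <;> constructor <;> nlinarith

/-- The difference of the inverse gaps `1 / (M - r)` along two ingoing rays. -/
theorem tendsto_inv_gap_sub_inv_gap {M : ℝ} {rinv : ℝ → ℝ} (hM : 0 < M)
    (hinv : ∀ s : ℝ, M + 2 * M * Real.log M < s →
      rinv s ∈ Set.Ioo 0 M ∧ rstar M (rinv s) = s) (v₀ v : ℝ) :
    Tendsto (fun u => (M - rinv (v - u))⁻¹ - (M - rinv (v₀ - u))⁻¹) atBot
      (𝓝 ((v - v₀) / M ^ 2)) := by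
  have hray (w : ℝ) : Tendsto (fun u : ℝ => w - u) atBot atTop :=
    tendsto_atTop_add_const_left _ w tendsto_neg_atBot_atTop
  have ha := (tendsto_horizon_gap hinv).comp (hray v)
  have hb := (tendsto_horizon_gap hinv).comp (hray v₀)
  simp only [Function.comp_def] at ha hb
  have hmem (w : ℝ) := (hray w).eventually_gt_atTop (M + 2 * M * Real.log M)
  have hquot : Tendsto (fun u => (Real.log (M - rinv (v₀ - u)) - Real.log (M - rinv (v - u))) /
      ((M - rinv (v - u))⁻¹ - (M - rinv (v₀ - u))⁻¹)) atBot (𝓝 0) := by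
    refine squeeze_zero_norm' ?_ (by simpa using ha.add hb)
    filter_upwards [hmem v, hmem v₀] with u hu hu₀
    exact abs_log_div_inv_sub_inv_le (sub_pos.2 (hinv _ hu).1.2) (sub_pos.2 (hinv _ hu₀).1.2)
  have hden := ((tendsto_const_nhds (x := M ^ 2)).sub (hquot.const_mul (2 * M))).add (ha.mul hb)
  simp only [mul_zero, sub_zero, add_zero] at hden
  have hM2 : M ^ 2 ≠ 0 := by positivity
  refine ((tendsto_const_nhds (x := v - v₀)).div hden hM2).congr' ?_
  filter_upwards [hmem v, hmem v₀, hden.eventually_ne hM2] with u hu hu₀ hne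
  obtain ⟨⟨-, hlt⟩, heq⟩ := hinv _ hu
  obtain ⟨⟨-, hlt₀⟩, heq₀⟩ := hinv _ hu₀
  simp only [Pi.div_apply]
  rw [div_eq_iff hne]
  unfold rstar at heq heq₀
  have ha0 : M - rinv (v - u) ≠ 0 := by linarith
  have hb0 : M - rinv (v₀ - u) ≠ 0 := by linarith
  have hdiff : v - v₀ = M ^ 2 * ((M - rinv (v - u))⁻¹ - (M - rinv (v₀ - u))⁻¹)
      - 2 * M * (Real.log (M - rinv (v₀ - u)) - Real.log (M - rinv (v - u)))
      + ((M - rinv (v₀ - u)) - (M - rinv (v - u))) := by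
    rw [div_eq_mul_inv] at heq heq₀
    linarith
  rw [hdiff]
  generalize M - rinv (v - u) = a at *
  generalize M - rinv (v₀ - u) = b at *
  have hprod : b - a = a * b * (a⁻¹ - b⁻¹) := by field_simp
  have hcancel : (Real.log b - Real.log a) / (a⁻¹ - b⁻¹) * (a⁻¹ - b⁻¹) =
      Real.log b - Real.log a := by
    refine div_mul_cancel_of_imp fun h => ?_
    rw [inv_injective (sub_eq_zero.1 h), sub_self]
  linear_combination hprod + 2 * M * hcancel

/-- Leading-order behaviour of `-∂_U r = Ω²(u,v)/Ω²(u,v₀)` towards the event horizon: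
for fixed `v₀ ≤ v`, `Ω²(u,v)/Ω²(u,v₀) → 1` and
`(v-u)(1 - Ω²(u,v)/Ω²(u,v₀)) → 2(v - v₀)` as `u → -∞`. -/
theorem Om2_ratio_event_horizon (M : ℝ) (hM : 0 < M) (rinv : ℝ → ℝ)
    (hinv : ∀ s : ℝ, M + 2 * M * Real.log M < s →
      rinv s ∈ Set.Ioo 0 M ∧ rstar M (rinv s) = s)
    (v₀ v : ℝ) (hv : v₀ ≤ v) :
    Tendsto (fun u => Om2 M rinv u v / Om2 M rinv u v₀) atBot (𝓝 1) ∧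
    Tendsto (fun u => (v - u) * (1 - Om2 M rinv u v / Om2 M rinv u v₀))
      atBot (𝓝 (2 * (v - v₀))) := by
  have hray (w : ℝ) : Tendsto (fun u : ℝ => w - u) atBot atTop :=
    tendsto_atTop_add_const_left _ w tendsto_neg_atBot_atTop
  have hmem (w : ℝ) := (hray w).eventually_gt_atTop (M + 2 * M * Real.log M)
  have ha := (tendsto_horizon_gap hinv).comp (hray v)
  have hsa := (tendsto_mul_horizon_gap hinv).comp (hray v)
  have hD := tendsto_inv_gap_sub_inv_gap hM hinv v₀ v
  simp only [Function.comp_def] at ha hsa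
  have hr : Tendsto (fun u => rinv (v - u)) atBot (𝓝 M) := by
    simpa using (tendsto_const_nhds (x := M)).sub ha
  have hfac := (hD.const_mul M).div hr hM.ne'
  have he := ha.mul hfac
  have hse := hsa.mul hfac
  rw [zero_mul] at he
  have hlim : M ^ 2 * (M * ((v - v₀) / M ^ 2) / M) = v - v₀ := by field_simp
  rw [hlim] at hse
  have hratio : ∀ᶠ u in atBot, Om2 M rinv u v / Om2 M rinv u v₀ =
      (1 - (M - rinv (v - u)) *
        (M * ((M - rinv (v - u))⁻¹ - (M - rinv (v₀ - u))⁻¹) / rinv (v - u))) ^ 2 := by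
    filter_upwards [hmem v, hmem v₀] with u hu hu₀
    obtain ⟨hpos, hlt⟩ := (hinv _ hu).1
    obtain ⟨hpos₀, hlt₀⟩ := (hinv _ hu₀).1
    have ha0 : M - rinv (v - u) ≠ 0 := by linarith
    have hb0 : M - rinv (v₀ - u) ≠ 0 := by linarith
    unfold Om2
    rw [← div_pow, one_sub_div hpos.ne', one_sub_div hpos₀.ne']
    have hb0' : rinv (v₀ - u) - M ≠ 0 := by linarith
    congr 1
    field_simp
    ring
  constructor
  · have h := ((tendsto_const_nhds (x := (1 : ℝ))).sub he).pow 2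
    rw [sub_zero, one_pow] at h
    exact h.congr' (hratio.mono fun u hu => hu.symm)
  · have h := hse.mul ((tendsto_const_nhds (x := (2 : ℝ))).sub he)
    rw [sub_zero, mul_comm (v - v₀)] at h
    refine h.congr' (hratio.mono fun u hu => ?_)
    simp only [Pi.div_apply]
    rw [hu]
    ring

end
end

section
/- Fix M > 0 and u₀ < 0, and define r(u,v) := r_*⁻¹(v−u) and Ω²(u,v) := (1 − M/r(u,v))². Then for every fixed u ≤ u₀ (with v − u > M + 2M·log M for v considered): lim_{v→∞} Ω²(u,v)/Ω²(u₀,v) = 1, and lim_{v→∞} (v−u)·(1 − Ω²(u,v)/Ω²(u₀,v)) = 2(u₀ − u). -/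
open Filter Set Topology

noncomputable section

/-- In terms of `q = M / (M - ρ)` the tortoise function is `M (q - 2 log q - 1/q)` up to a
constant. -/
theorem rstar_eq_div (M ρ : ℝ) (hρ : ρ ∈ Set.Ioo 0 M) :
    rstar M ρ = M * (M / (M - ρ) - 2 * Real.log (M / (M - ρ)) - (M / (M - ρ))⁻¹)
      + (2 * M * Real.log M + M) := by
  have hM : 0 < M := hρ.1.trans hρ.2
  have hx : 0 < M - ρ := sub_pos.2 hρ.2
  rw [Real.log_div hM.ne' hx.ne', rstar]
  field_simp
  ring

theorem one_lt_div_sub {M ρ : ℝ} (hρ : ρ ∈ Set.Ioo 0 M) : 1 < M / (M - ρ) := by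
  rw [one_lt_div (sub_pos.2 hρ.2)]
  linarith [hρ.1]

theorem one_sub_div_sq_eq {M ρ : ℝ} (hρ : ρ ∈ Set.Ioo 0 M) :
    (1 - M / ρ) ^ 2 = ((M / (M - ρ) - 1) ^ 2)⁻¹ := by
  have hx : M - ρ ≠ 0 := (sub_pos.2 hρ.2).ne'
  have hρ0 : ρ ≠ 0 := hρ.1.ne'
  have h : M / (M - ρ) - 1 = ρ / (M - ρ) := by
    field_simp
    ring
  rw [h]
  field_simp
  ring

section Asymptotics

variable {M C : ℝ} {q : ℝ → ℝ}

theorem tendsto_atTop_of_log_equation (hM : 0 < M)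
    (hq : ∀ᶠ s in atTop, 1 < q s ∧ s = M * (q s - 2 * Real.log (q s) - (q s)⁻¹) + C) :
    Tendsto q atTop atTop := by
  have hlin : Tendsto (fun s : ℝ => (s - C) / M) atTop atTop :=
    (tendsto_atTop_add_const_right _ (-C) tendsto_id).atTop_div_const hM
  refine tendsto_atTop_mono' _ ?_ hlin
  filter_upwards [hq] with s hs
  have hlog := Real.log_pos hs.1
  have hinv : 0 < (q s)⁻¹ := inv_pos.2 (one_pos.trans hs.1)
  rw [div_le_iff₀ hM]
  nlinarith [hs.2, mul_pos hM hlog, mul_pos hM hinv]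

theorem tendsto_div_of_log_equation (hM : 0 < M)
    (hq : ∀ᶠ s in atTop, 1 < q s ∧ s = M * (q s - 2 * Real.log (q s) - (q s)⁻¹) + C) :
    Tendsto (fun s => s / q s) atTop (𝓝 M) := by
  have htop := tendsto_atTop_of_log_equation hM hq
  have hinv := tendsto_inv_atTop_zero.comp htop
  have hlog := Real.isLittleO_log_id_atTop.tendsto_div_nhds_zero.comp htop
  have hlim : Tendsto (fun s => M * (1 - 2 * (Real.log (q s) / q s) - (q s)⁻¹ * (q s)⁻¹)
      + C * (q s)⁻¹) atTop (𝓝 (M * (1 - 2 * 0 - 0 * 0) + C * 0)) :=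
    (((tendsto_const_nhds.sub (hlog.const_mul 2)).sub (hinv.mul hinv)).const_mul M).add
      (hinv.const_mul C)
  simp only [mul_zero, sub_zero, mul_one, add_zero] at hlim
  refine hlim.congr' ?_
  filter_upwards [hq] with s hs
  have h0 : q s ≠ 0 := (one_pos.trans hs.1).ne'
  rw [eq_div_iff h0]
  refine Eq.trans ?_ hs.2.symm
  field_simp

theorem tendsto_shift_div_of_log_equation (hM : 0 < M) (d : ℝ)
    (hq : ∀ᶠ s in atTop, 1 < q s ∧ s = M * (q s - 2 * Real.log (q s) - (q s)⁻¹) + C) :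
    Tendsto (fun s => q (s + d) / q s) atTop (𝓝 1) := by
  have hdiv := tendsto_div_of_log_equation hM hq
  have hshift : Tendsto (fun s : ℝ => s + d) atTop atTop :=
    tendsto_atTop_add_const_right _ d tendsto_id
  have hratio : Tendsto (fun s : ℝ => 1 + d * s⁻¹) atTop (𝓝 (1 + d * 0)) :=
    tendsto_const_nhds.add (tendsto_inv_atTop_zero.const_mul d)
  have hlim := (((hdiv.comp hshift).inv₀ hM.ne').mul hratio).mul hdiv
  have hval : M⁻¹ * (1 + d * 0) * M = 1 := by
    field_simp
    ring
  rw [hval] at hlim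
  refine hlim.congr' ?_
  filter_upwards [hq, hshift.eventually hq, eventually_gt_atTop 0,
    hshift.eventually (eventually_gt_atTop 0)] with s hs hsd hs0 hsd0
  have h0 : q s ≠ 0 := (one_pos.trans hs.1).ne'
  have h1 : q (s + d) ≠ 0 := (one_pos.trans hsd.1).ne'
  simp only [Function.comp_apply]
  field_simp

theorem tendsto_shift_sub_of_log_equation (hM : 0 < M) (d : ℝ)
    (hq : ∀ᶠ s in atTop, 1 < q s ∧ s = M * (q s - 2 * Real.log (q s) - (q s)⁻¹) + C) :
    Tendsto (fun s => q (s + d) - q s) atTop (𝓝 (d / M)) := by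
  have hshift : Tendsto (fun s : ℝ => s + d) atTop atTop :=
    tendsto_atTop_add_const_right _ d tendsto_id
  have hinv := tendsto_inv_atTop_zero.comp (tendsto_atTop_of_log_equation hM hq)
  have hlog := (tendsto_shift_div_of_log_equation hM d hq).log one_ne_zero
  have hlim := ((hlog.const_mul 2).const_add (d / M)).add ((hinv.comp hshift).sub hinv)
  simp only [Real.log_one, mul_zero, sub_zero, add_zero] at hlim
  refine hlim.congr' ?_
  filter_upwards [hq, hshift.eventually hq] with s hs hsd
  have h0 : q s ≠ 0 := (one_pos.trans hs.1).ne'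
  have h1 : q (s + d) ≠ 0 := (one_pos.trans hsd.1).ne'
  have hd : d / M = (q (s + d) - 2 * Real.log (q (s + d)) - (q (s + d))⁻¹)
      - (q s - 2 * Real.log (q s) - (q s)⁻¹) := by
    rw [div_eq_iff hM.ne']
    linarith [hs.2, hsd.2]
  simp only [Function.comp_apply]
  rw [Real.log_div h1 h0, hd]
  ring

end Asymptotics

/-- Leading-order behaviour of `∂_V r = Ω²(u,v)/Ω²(u₀,v)` towards the Cauchy horizon:
for fixed `u ≤ u₀`, `Ω²(u,v)/Ω²(u₀,v) → 1` and
`(v-u)(1 - Ω²(u,v)/Ω²(u₀,v)) → 2(u₀ - u)` as `v → ∞`. -/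
theorem Om2_ratio_cauchy_horizon (M : ℝ) (hM : 0 < M) (u₀ : ℝ) (hu₀ : u₀ < 0)
    (rinv : ℝ → ℝ)
    (hinv : ∀ s : ℝ, M + 2 * M * Real.log M < s →
      rinv s ∈ Set.Ioo 0 M ∧ rstar M (rinv s) = s)
    (u : ℝ) (hu : u ≤ u₀) :
    Tendsto (fun v => Om2 M rinv u v / Om2 M rinv u₀ v) atTop (𝓝 1) ∧
    Tendsto (fun v => (v - u) * (1 - Om2 M rinv u v / Om2 M rinv u₀ v))
      atTop (𝓝 (2 * (u₀ - u))) := by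
  set q : ℝ → ℝ := fun s => M / (M - rinv s) with hq_def
  have hq : ∀ᶠ s in atTop, 1 < q s ∧
      s = M * (q s - 2 * Real.log (q s) - (q s)⁻¹) + (2 * M * Real.log M + M) := by
    filter_upwards [eventually_gt_atTop (M + 2 * M * Real.log M)] with s hs
    obtain ⟨hmem, hs_eq⟩ := hinv s hs
    exact ⟨one_lt_div_sub hmem, hs_eq.symm.trans (rstar_eq_div M _ hmem)⟩
  have hv (a : ℝ) : Tendsto (fun v : ℝ => v - a) atTop atTop :=
    tendsto_atTop_add_const_right _ (-a) tendsto_id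
  have hshift (v : ℝ) : v - u₀ + (u₀ - u) = v - u := by ring
  have hOm (a : ℝ) : ∀ᶠ v in atTop, 1 < q (v - a) ∧
      Om2 M rinv a v = ((q (v - a) - 1) ^ 2)⁻¹ := by
    filter_upwards [(hv a).eventually (eventually_gt_atTop (M + 2 * M * Real.log M))] with v h
    exact ⟨one_lt_div_sub (hinv _ h).1, one_sub_div_sq_eq (hinv _ h).1⟩
  have hinv_q : Tendsto (fun v => (q (v - u))⁻¹) atTop (𝓝 0) :=
    tendsto_inv_atTop_zero.comp ((tendsto_atTop_of_log_equation hM hq).comp (hv u))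
  have hdiff : Tendsto (fun v => q (v - u) - q (v - u₀)) atTop (𝓝 ((u₀ - u) / M)) := by
    simpa only [Function.comp_def, hshift] using
      (tendsto_shift_sub_of_log_equation hM (u₀ - u) hq).comp (hv u₀)
  have hdiv : Tendsto (fun v => (v - u) / q (v - u)) atTop (𝓝 M) :=
    (tendsto_div_of_log_equation hM hq).comp (hv u)
  have hfactor : Tendsto (fun v => (1 - (q (v - u))⁻¹)⁻¹) atTop (𝓝 1) := by
    simpa using (hinv_q.const_sub 1).inv₀ (by norm_num)
  have hp : Tendsto (fun v => (q (v - u₀) - 1) / (q (v - u) - 1)) atTop (𝓝 1) := by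
    have hlim := ((hdiff.mul hinv_q).mul hfactor).const_sub 1
    simp only [mul_zero, zero_mul, sub_zero] at hlim
    refine hlim.congr' ?_
    filter_upwards [hOm u] with v h
    have h0 : q (v - u) ≠ 0 := (one_pos.trans h.1).ne'
    have h1 : q (v - u) - 1 ≠ 0 := (sub_pos.2 h.1).ne'
    field_simp
    ring
  have hratio : (fun v => ((q (v - u₀) - 1) / (q (v - u) - 1)) ^ 2) =ᶠ[atTop]
      fun v => Om2 M rinv u v / Om2 M rinv u₀ v := by
    filter_upwards [hOm u, hOm u₀] with v h h₀
    rw [h.2, h₀.2, div_pow, div_inv_eq_mul, div_eq_mul_inv, mul_comm]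
  constructor
  · simpa using (hp.pow 2).congr' hratio
  · have hlim := ((hdiv.mul hfactor).mul hdiff).mul (hp.const_add 1)
    have hval : M * 1 * ((u₀ - u) / M) * (1 + 1) = 2 * (u₀ - u) := by
      field_simp
      ring
    rw [hval] at hlim
    refine hlim.congr' ?_
    filter_upwards [hOm u, hratio] with v h hr
    have h0 : q (v - u) ≠ 0 := (one_pos.trans h.1).ne'
    have h1 : q (v - u) - 1 ≠ 0 := (sub_pos.2 h.1).ne'
    rw [← hr]
    field_simp
    ring

end
end

section
/- Let φ be a spherically symmetric wave on D whose horizon limits φ_H and φ_H' exist, and fix −1 < q < 1 with F_q[φ] := ∫_{−∞}^{u₀} |∂_u φ|(u',v₀) du' + ∫_{v₀}^{∞} v'^{−q}·|φ_H'(v')| dv' < ∞. Then there exists a constant C = C(M, u₀, v₀, q) > 0, independent of φ, such that for all (u,v) ∈ D: |φ(u,v)| ≤ |φ_H(v)| + C·F_q[φ]. -/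
open Filter MeasureTheory Set Topology intervalIntegral

noncomputable section

/-- The data of a spherically symmetric wave on the interior region
`D = (-∞, u₀] × [v₀, ∞)` of extremal Reissner--Nordström: the radius function `r`,
the wave `φ` together with its partial derivatives, and the wave equation. -/
structure WaveSetup (M u₀ v₀ : ℝ) where
  hM : 0 < M
  hu₀ : u₀ < 0
  hv₀ : 0 < v₀
  hdom : M + 2 * M * Real.log M < v₀ - u₀
  /-- the area radius function, defined implicitly by `rstar M (r u v) = v - u` -/
  r : ℝ → ℝ → ℝ
  hr_mem : ∀ u v : ℝ, M + 2 * M * Real.log M < v - u → r u v ∈ Set.Ioo 0 M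
  hr_star : ∀ u v : ℝ, M + 2 * M * Real.log M < v - u → rstar M (r u v) = v - u
  /-- the wave -/
  φ : ℝ → ℝ → ℝ
  /-- `∂_u φ` -/
  φu : ℝ → ℝ → ℝ
  /-- `∂_v φ` -/
  φv : ℝ → ℝ → ℝ
  /-- `∂_v ∂_u φ` -/
  φuv : ℝ → ℝ → ℝ
  /-- `∂_v ∂_v φ` -/
  φvv : ℝ → ℝ → ℝ
  hφu : ∀ u ∈ Set.Iic u₀, ∀ v ∈ Set.Ici v₀,
    HasDerivWithinAt (fun u' => φ u' v) (φu u v) (Set.Iic u₀) u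
  hφv : ∀ u ∈ Set.Iic u₀, ∀ v ∈ Set.Ici v₀,
    HasDerivWithinAt (fun v' => φ u v') (φv u v) (Set.Ici v₀) v
  hφuv : ∀ u ∈ Set.Iic u₀, ∀ v ∈ Set.Ici v₀,
    HasDerivWithinAt (fun v' => φu u v') (φuv u v) (Set.Ici v₀) v
  hφvv : ∀ u ∈ Set.Iic u₀, ∀ v ∈ Set.Ici v₀,
    HasDerivWithinAt (fun v' => φv u v') (φvv u v) (Set.Ici v₀) v
  hφ_cont : ContinuousOn (fun p : ℝ × ℝ => φ p.1 p.2) (Set.Iic u₀ ×ˢ Set.Ici v₀)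
  hφu_cont : ContinuousOn (fun p : ℝ × ℝ => φu p.1 p.2) (Set.Iic u₀ ×ˢ Set.Ici v₀)
  hφv_cont : ContinuousOn (fun p : ℝ × ℝ => φv p.1 p.2) (Set.Iic u₀ ×ˢ Set.Ici v₀)
  /-- the wave equation `r ∂_u∂_v φ + (∂_u r) ∂_v φ + (∂_v r) ∂_u φ = 0`,
  with `∂_u r = -Ω²` and `∂_v r = Ω²`, `Ω² = (1 - M/r)²`. -/
  hwave : ∀ u ∈ Set.Iic u₀, ∀ v ∈ Set.Ici v₀,
    r u v * φuv u v - (1 - M / r u v) ^ 2 * φv u v + (1 - M / r u v) ^ 2 * φu u v = 0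

namespace WaveSetup

variable {M u₀ v₀ : ℝ}

/-- The conformal factor `Ω²(u,v) = (1 - M/r(u,v))²`. -/
def Ω2 (W : WaveSetup M u₀ v₀) (u v : ℝ) : ℝ := (1 - M / W.r u v) ^ 2

/-- The regular outgoing derivative `∂_V φ = Ω⁻²(u₀,v) ∂_v φ`. -/
def dVφ (W : WaveSetup M u₀ v₀) (u v : ℝ) : ℝ := (W.Ω2 u₀ v)⁻¹ * W.φv u v

/-- The regular outgoing derivative of `r φ`:
`∂_V (r φ) = Ω⁻²(u₀,v) (∂_v r · φ + r ∂_v φ)` with `∂_v r = Ω²(u,v)`. -/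
def dVrφ (W : WaveSetup M u₀ v₀) (u v : ℝ) : ℝ :=
  (W.Ω2 u₀ v)⁻¹ * (W.Ω2 u v * W.φ u v + W.r u v * W.φv u v)

/-- The second regular outgoing derivative `∂_V² φ = Ω⁻²(u₀,v) ∂_v (∂_V φ)`,
computed using `∂_v Ω²(u₀,v) = 2 (1 - M/r)(M/r²) Ω²(u₀,v)`. -/
def dV2φ (W : WaveSetup M u₀ v₀) (u v : ℝ) : ℝ :=
  ((W.Ω2 u₀ v)⁻¹) ^ 2 * W.φvv u v
    - 2 * (1 - M / W.r u₀ v) * (M / (W.r u₀ v) ^ 2) * ((W.Ω2 u₀ v)⁻¹) ^ 2 * W.φv u v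

/-- `∂_u (r φ) = (∂_u r) φ + r ∂_u φ = -Ω² φ + r ∂_u φ`. -/
def duRφ (W : WaveSetup M u₀ v₀) (u v : ℝ) : ℝ :=
  -W.Ω2 u v * W.φ u v + W.r u v * W.φu u v

end WaveSetup

/-- A spherically symmetric wave whose horizon limits exist:
`φ_H(v) = lim_{u → -∞} φ(u,v)` and `φ_H'(v) = lim_{u → -∞} ∂_v φ(u,v)` exist
locally uniformly in `v`, with `φ_H` differentiable and `(φ_H)' = φ_H'`. -/
structure WaveSetupH (M u₀ v₀ : ℝ) extends WaveSetup M u₀ v₀ where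
  φH : ℝ → ℝ
  φH' : ℝ → ℝ
  hφH_tendsto : TendstoLocallyUniformlyOn (fun u v => φ u v) φH Filter.atBot (Set.Ici v₀)
  hφH'_tendsto : TendstoLocallyUniformlyOn (fun u v => φv u v) φH' Filter.atBot (Set.Ici v₀)
  hφH_deriv : ∀ v ∈ Set.Ici v₀, HasDerivWithinAt φH (φH' v) (Set.Ici v₀) v

end

/-- **Grönwall's inequality**, integral form. -/
theorem le_exp_mul_of_le_integral {a b c : ℝ} {f κ g : ℝ → ℝ} (hab : a ≤ b)
    (hf : Continuous f) (hκ : Continuous κ) (hg : Continuous g)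
    (hκ0 : ∀ x ∈ Icc a b, 0 ≤ κ x) (hg0 : ∀ x ∈ Icc a b, 0 ≤ g x)
    (h : ∀ x ∈ Icc a b, f x ≤ c + ∫ t in a..x, (κ t * f t + g t)) :
    f b ≤ Real.exp (∫ t in a..b, κ t) * (c + ∫ t in a..b, g t) := by
  set R : ℝ → ℝ := fun x => c + ∫ t in a..x, (κ t * f t + g t) with hR
  set k : ℝ → ℝ := fun x => ∫ t in a..x, κ t with hk
  set Z : ℝ → ℝ := fun x => R x * Real.exp (-k x) - ∫ t in a..x, g t with hZ
  have hRd : ∀ x, HasDerivAt R (κ x * f x + g x) x := fun x =>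
    ((by fun_prop : Continuous fun t => κ t * f t + g t).integral_hasStrictDerivAt a
      x).hasDerivAt.const_add c
  have hkd : ∀ x, HasDerivAt k (κ x) x := fun x => (hκ.integral_hasStrictDerivAt a x).hasDerivAt
  have hgd : ∀ x, HasDerivAt (fun x => ∫ t in a..x, g t) (g x) x := fun x =>
    (hg.integral_hasStrictDerivAt a x).hasDerivAt
  have hZd : ∀ x, HasDerivAt Z ((κ x * f x + g x) * Real.exp (-k x)
      + R x * (Real.exp (-k x) * -κ x) - g x) x := fun x =>
    ((hRd x).mul (hkd x).neg.exp).sub (hgd x)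
  have hanti : AntitoneOn Z (Icc a b) := by
    refine antitoneOn_of_deriv_nonpos (convex_Icc a b)
      (fun x _ => (hZd x).continuousAt.continuousWithinAt)
      (fun x _ => (hZd x).differentiableAt.differentiableWithinAt) fun x hx => ?_
    have hx' : x ∈ Icc a b := interior_subset hx
    rw [(hZd x).deriv]
    have hk0 : 0 ≤ k x :=
      intervalIntegral.integral_nonneg hx'.1 fun t ht => hκ0 t ⟨ht.1, ht.2.trans hx'.2⟩
    have he : Real.exp (-k x) ≤ 1 := Real.exp_le_one_iff.2 (by linarith)
    have h1 : κ x * (f x - R x) ≤ 0 :=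
      mul_nonpos_of_nonneg_of_nonpos (hκ0 x hx') (by linarith [h x hx'])
    have h2 := mul_nonpos_of_nonpos_of_nonneg h1 (Real.exp_pos (-k x)).le
    have h3 := mul_le_mul_of_nonneg_left he (hg0 x hx')
    nlinarith
  have hZb := hanti (left_mem_Icc.2 hab) (right_mem_Icc.2 hab) hab
  have hfin : R b * Real.exp (-k b) ≤ c + ∫ t in a..b, g t := by
    have hZa : Z a = c := by simp [hZ, hR, hk]
    rw [hZa] at hZb
    linarith
  calc f b ≤ R b := h b (right_mem_Icc.2 hab)
    _ = Real.exp (k b) * (R b * Real.exp (-k b)) := by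
        rw [mul_comm (R b), ← mul_assoc, ← Real.exp_add]; simp
    _ ≤ _ := mul_le_mul_of_nonneg_left hfin (Real.exp_pos _).le

theorem integral_integral_swap_of_continuous {h : ℝ → ℝ → ℝ} {a b c d : ℝ}
    (hh : Continuous fun x : ℝ × ℝ => h x.1 x.2) :
    ∫ x in a..b, ∫ y in c..d, h x y = ∫ y in c..d, ∫ x in a..b, h x y := by
  refine intervalIntegral_intervalIntegral_swap ?_
  exact (hh.continuousOn.integrableOn_compact (isCompact_uIcc.prod isCompact_uIcc)).mono_set
    (prod_mono uIoc_subset_uIcc uIoc_subset_uIcc)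

theorem integral_inv_sub_sq {a b v : ℝ} (hab : a ≤ b) (hb : b < v) :
    ∫ u in a..b, ((v - u) ^ 2)⁻¹ = (v - b)⁻¹ - (v - a)⁻¹ := by
  refine intervalIntegral.integral_eq_sub_of_hasDerivAt (f := fun u => (v - u)⁻¹) ?_ ?_
  · intro u hu
    rw [uIcc_of_le hab] at hu
    have hne : v - u ≠ 0 := by linarith [hu.2]
    simpa using ((hasDerivAt_id u).const_sub v).fun_inv hne
  · refine ContinuousOn.intervalIntegrable ?_
    rw [uIcc_of_le hab]
    refine ContinuousOn.inv₀ (by fun_prop) fun u hu => ?_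
    have : 0 < v - u := by linarith [hu.2]
    positivity

theorem integral_inv_sq {a b : ℝ} (ha : 0 < a) (hab : a ≤ b) :
    ∫ v in a..b, (v ^ 2)⁻¹ = a⁻¹ - b⁻¹ := by
  rw [show a⁻¹ - b⁻¹ = -b⁻¹ - -a⁻¹ by ring]
  refine intervalIntegral.integral_eq_sub_of_hasDerivAt (f := fun v => -v⁻¹) ?_ ?_
  · intro u hu
    rw [uIcc_of_le hab] at hu
    have hne : u ≠ 0 := by linarith [hu.1]
    simpa using (hasDerivAt_inv hne).fun_neg
  · refine ContinuousOn.intervalIntegrable ?_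
    rw [uIcc_of_le hab]
    refine ContinuousOn.inv₀ (by fun_prop) fun u hu => ?_
    have : 0 < u := by linarith [hu.1]
    positivity

/-- An `L¹` estimate for the characteristic system `∂_v p = ∂_u s = K (s - p)` on a rectangle,
where `K` decays like `(v - u)⁻²`; the constant does not depend on the rectangle. -/
theorem integral_abs_le_of_characteristic_system {p s K : ℝ → ℝ → ℝ} {k U u₀ v₀ V : ℝ}
    (hp : Continuous fun x : ℝ × ℝ => p x.1 x.2) (hs : Continuous fun x : ℝ × ℝ => s x.1 x.2)
    (hK : Continuous fun x : ℝ × ℝ => K x.1 x.2)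
    (hk : 0 ≤ k) (hu₀ : u₀ < 0) (hv₀ : 0 < v₀) (hU : U ≤ u₀) (hV : v₀ ≤ V)
    (hK0 : ∀ u ≤ u₀, ∀ v, v₀ ≤ v → 0 ≤ K u v)
    (hKle : ∀ u ≤ u₀, ∀ v, v₀ ≤ v → K u v ≤ k * ((v - u) ^ 2)⁻¹)
    (hpeq : ∀ u ≤ u₀, ∀ v, v₀ ≤ v → p u v = p u v₀ + ∫ w in v₀..v, K u w * (s u w - p u w))
    (hseq : ∀ u, U ≤ u → u ≤ u₀ → ∀ v, v₀ ≤ v →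
      s u v = s U v + ∫ w in U..u, K w v * (s w v - p w v)) :
    ∫ u in U..u₀, |p u V| ≤
      Real.exp ((k + k ^ 2 * Real.exp (k / v₀) / v₀) / v₀) * ((∫ u in U..u₀, |p u v₀|) +
        k * Real.exp (k / v₀) * ∫ v in v₀..V, v⁻¹ * |s U v|) := by
  set e := Real.exp (k / v₀) with he
  have he0 : 0 < e := Real.exp_pos _
  set A := k + k ^ 2 * e / v₀ with hA
  have hA0 : 0 ≤ A := by positivity
  set J : ℝ → ℝ := fun v => ∫ u in U..u₀, |p u v| with hJ
  have hJc : Continuous J :=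
    intervalIntegral.continuous_parametric_intervalIntegral_of_continuous' (f := fun v u => |p u v|)
      (hp.comp continuous_swap).abs U u₀
  have hpu : ∀ v, Continuous fun u => p u v := fun v => by fun_prop
  have hsu : ∀ v, Continuous fun u => s u v := fun v => by fun_prop
  have hKu : ∀ v, Continuous fun u => K u v := fun v => by fun_prop
  have hpv : ∀ u, Continuous fun v => p u v := fun u => by fun_prop
  have hsv : ∀ u, Continuous fun v => s u v := fun u => by fun_prop
  have hKv : ∀ u, Continuous fun v => K u v := fun u => by fun_prop
  have hKpc : ∀ v, Continuous fun u => K u v * |p u v| := fun v => (hKu v).mul (hpu v).abs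
  have hJ0 : ∀ v, 0 ≤ J v := fun v => intervalIntegral.integral_nonneg hU fun _ _ => abs_nonneg _
  have hKle' : ∀ u ≤ u₀, ∀ v, v₀ ≤ v → K u v ≤ k * (v ^ 2)⁻¹ := by
    intro u hu v hv
    refine (hKle u hu v hv).trans (mul_le_mul_of_nonneg_left ?_ hk)
    have : 0 < v := by linarith
    gcongr
    linarith
  have hKint : ∀ u, U ≤ u → u ≤ u₀ → ∀ v, v₀ ≤ v → ∫ w in U..u, K w v ≤ k * v⁻¹ := by
    intro u hUu hu v hv
    have hv0 : 0 < v := by linarith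
    calc ∫ w in U..u, K w v ≤ ∫ w in U..u, k * ((v - w) ^ 2)⁻¹ := by
          refine intervalIntegral.integral_mono_on hUu ((hKu v).intervalIntegrable _ _) ?_
            fun w hw => hKle w (hw.2.trans hu) v hv
          refine ContinuousOn.intervalIntegrable ?_
          rw [uIcc_of_le hUu]
          refine continuousOn_const.mul (ContinuousOn.inv₀ (by fun_prop) fun w hw => ?_)
          have : 0 < v - w := by linarith [hw.2]
          positivity
      _ = k * ((v - u)⁻¹ - (v - U)⁻¹) := by
          rw [intervalIntegral.integral_const_mul, integral_inv_sub_sq hUu (by linarith)]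
      _ ≤ k * v⁻¹ := by
          have h1 : (v - u)⁻¹ ≤ v⁻¹ := by gcongr; linarith
          have h2 : 0 ≤ (v - U)⁻¹ := inv_nonneg.2 (by linarith)
          gcongr
          linarith
  have hKp : ∀ u, U ≤ u → u ≤ u₀ → ∀ v, v₀ ≤ v →
      ∫ w in U..u, K w v * |p w v| ≤ k * (v ^ 2)⁻¹ * J v := by
    intro u hUu hu v hv
    have hc : Continuous fun w => k * (v ^ 2)⁻¹ * |p w v| := (hpu v).abs.const_mul _
    calc ∫ w in U..u, K w v * |p w v| ≤ ∫ w in U..u, k * (v ^ 2)⁻¹ * |p w v| :=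
          intervalIntegral.integral_mono_on hUu ((hKpc v).intervalIntegrable _ _)
            (hc.intervalIntegrable _ _) fun w hw =>
            mul_le_mul_of_nonneg_right (hKle' w (hw.2.trans hu) v hv) (abs_nonneg _)
      _ ≤ ∫ w in U..u₀, k * (v ^ 2)⁻¹ * |p w v| :=
          intervalIntegral.integral_mono_interval le_rfl hUu hu
            (Filter.Eventually.of_forall fun w => by positivity) (hc.intervalIntegrable _ _)
      _ = _ := intervalIntegral.integral_const_mul _ _
  have hsle : ∀ u, U ≤ u → u ≤ u₀ → ∀ v, v₀ ≤ v →
      |s u v| ≤ e * (|s U v| + k * (v ^ 2)⁻¹ * J v) := by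
    intro u hUu hu v hv
    have hv0 : 0 < v := by linarith
    have hgr := le_exp_mul_of_le_integral (c := |s U v|) hUu (hsu v).abs (hKu v)
      (hKpc v) (fun x hx => hK0 x (hx.2.trans hu) v hv)
      (fun x hx => mul_nonneg (hK0 x (hx.2.trans hu) v hv) (abs_nonneg _))
      (fun x hx => by
        rw [hseq x hx.1 (hx.2.trans hu) v hv]
        refine (abs_add_le _ _).trans (add_le_add_right ?_ _)
        refine (intervalIntegral.abs_integral_le_integral_abs hx.1).trans ?_
        refine intervalIntegral.integral_mono_on hx.1
          (((hKu v).mul ((hsu v).sub (hpu v))).abs.intervalIntegrable _ _)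
          ((((hKu v).mul (hsu v).abs).add (hKpc v)).intervalIntegrable _ _)
          fun w hw => ?_
        have h0 := hK0 w (hw.2.trans (hx.2.trans hu)) v hv
        rw [abs_mul, abs_of_nonneg h0, ← mul_add]
        exact mul_le_mul_of_nonneg_left (abs_sub _ _) h0)
    refine hgr.trans (mul_le_mul ?_ ?_ ?_ he0.le)
    · refine Real.exp_le_exp.2 ((hKint u hUu hu v hv).trans ?_)
      rw [div_eq_mul_inv]
      gcongr
    · exact add_le_add_right (hKp u hUu hu v hv) _
    · exact add_nonneg (abs_nonneg _) (intervalIntegral.integral_nonneg hUu fun w hw =>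
        mul_nonneg (hK0 w (hw.2.trans hu) v hv) (abs_nonneg _))
  set h : ℝ → ℝ → ℝ := fun u v => K u v * (|s u v| + |p u v|) with hh
  have hhc : Continuous fun x : ℝ × ℝ => h x.1 x.2 := hK.mul (hs.abs.add hp.abs)
  have hhu : ∀ v, Continuous fun u => h u v := fun v => by fun_prop
  have hhv : ∀ u, Continuous fun v => h u v := fun u => by fun_prop
  have hhint : ∀ v, v₀ ≤ v → ∫ u in U..u₀, h u v ≤
      A * ((max v v₀) ^ 2)⁻¹ * J v + k * e * ((max v v₀)⁻¹ * |s U v|) := by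
    intro v hv
    have hv0 : 0 < v := by linarith
    rw [max_eq_left hv]
    set T := e * (|s U v| + k * (v ^ 2)⁻¹ * J v) with hT
    have hT0 : 0 ≤ T := mul_nonneg he0.le (add_nonneg (abs_nonneg _)
      (mul_nonneg (by positivity) (hJ0 v)))
    calc ∫ u in U..u₀, h u v ≤ ∫ u in U..u₀, (T * K u v + K u v * |p u v|) := by
          refine intervalIntegral.integral_mono_on hU ((hhu v).intervalIntegrable _ _)
            ((((hKu v).const_mul T).add (hKpc v)).intervalIntegrable _ _)
            fun u hu => ?_
          have := mul_le_mul_of_nonneg_left (hsle u hu.1 hu.2 v hv) (hK0 u hu.2 v hv)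
          simp only [hh]
          linarith
      _ = T * (∫ u in U..u₀, K u v) + ∫ u in U..u₀, K u v * |p u v| := by
          rw [intervalIntegral.integral_add (((hKu v).const_mul T).intervalIntegrable _ _)
            ((hKpc v).intervalIntegrable _ _),
            intervalIntegral.integral_const_mul]
      _ ≤ T * (k * v⁻¹) + k * (v ^ 2)⁻¹ * J v :=
          add_le_add (mul_le_mul_of_nonneg_left (hKint u₀ hU le_rfl v hv) hT0)
            (hKp u₀ hU le_rfl v hv)
      _ ≤ _ := by
          have h1 : v⁻¹ ≤ v₀⁻¹ := by gcongr
          have h2 : 0 ≤ k ^ 2 * e * ((v ^ 2)⁻¹ * J v) :=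
            mul_nonneg (by positivity) (mul_nonneg (by positivity) (hJ0 v))
          have h3 := mul_le_mul_of_nonneg_left h1 h2
          simp only [hT, hA, div_eq_mul_inv]
          linarith
  have hmax : ∀ v, 0 < max v v₀ := fun v => hv₀.trans_le (le_max_right _ _)
  have hκc : Continuous fun v => A * ((max v v₀) ^ 2)⁻¹ :=
    continuous_const.mul (Continuous.inv₀ (by fun_prop) fun v => (pow_pos (hmax v) 2).ne')
  have hgc : Continuous fun v => k * e * ((max v v₀)⁻¹ * |s U v|) :=
    continuous_const.mul ((Continuous.inv₀ (by fun_prop) fun v => (hmax v).ne').mul (hsv U).abs)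
  have hHc : Continuous fun v => ∫ u in U..u₀, h u v :=
    intervalIntegral.continuous_parametric_intervalIntegral_of_continuous' (f := fun v u => h u v)
      (hhc.comp continuous_swap) U u₀
  have hfin := le_exp_mul_of_le_integral (c := J v₀) hV hJc hκc hgc
    (fun v _ => by have := hmax v; positivity) (fun v _ => by have := hmax v; positivity)
    (fun v hv => by
      calc J v ≤ ∫ u in U..u₀, (|p u v₀| + ∫ w in v₀..v, h u w) := by
            refine intervalIntegral.integral_mono_on hU ((hpu v).abs.intervalIntegrable _ _)
              (((hpu v₀).abs.add
                (intervalIntegral.continuous_parametric_intervalIntegral_of_continuous'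
                  hhc v₀ v)).intervalIntegrable _ _) fun u hu => ?_
            rw [hpeq u hu.2 v hv.1]
            refine (abs_add_le _ _).trans (add_le_add_right ?_ _)
            refine (intervalIntegral.abs_integral_le_integral_abs hv.1).trans ?_
            refine intervalIntegral.integral_mono_on hv.1
              (((hKv u).mul ((hsv u).sub (hpv u))).abs.intervalIntegrable _ _)
              ((hhv u).intervalIntegrable _ _) fun w hw => ?_
            have h0 := hK0 u hu.2 w hw.1
            rw [abs_mul, abs_of_nonneg h0]
            exact mul_le_mul_of_nonneg_left (abs_sub _ _) h0
        _ = J v₀ + ∫ w in v₀..v, ∫ u in U..u₀, h u w := by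
            rw [intervalIntegral.integral_add ((hpu v₀).abs.intervalIntegrable _ _)
              ((intervalIntegral.continuous_parametric_intervalIntegral_of_continuous'
                  hhc v₀ v).intervalIntegrable _ _),
              integral_integral_swap_of_continuous hhc]
        _ ≤ _ := add_le_add_right (intervalIntegral.integral_mono_on hv.1
              (hHc.intervalIntegrable _ _)
              (((hκc.mul hJc).add hgc).intervalIntegrable _ _)
              fun w hw => hhint w hw.1) _)
  refine hfin.trans ?_
  have hrw : ∫ v in v₀..V, A * ((max v v₀) ^ 2)⁻¹ = A * (v₀⁻¹ - V⁻¹) := by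
    rw [intervalIntegral.integral_const_mul, ← integral_inv_sq hv₀ hV]
    congr 1
    refine intervalIntegral.integral_congr fun v hv => ?_
    rw [uIcc_of_le hV] at hv
    simp only [max_eq_left hv.1]
  have hrw' : ∫ v in v₀..V, k * e * ((max v v₀)⁻¹ * |s U v|) =
      k * e * ∫ v in v₀..V, v⁻¹ * |s U v| := by
    rw [intervalIntegral.integral_const_mul]
    congr 1
    refine intervalIntegral.integral_congr fun v hv => ?_
    rw [uIcc_of_le hV] at hv
    simp only [max_eq_left hv.1]
  rw [hrw, hrw']
  refine mul_le_mul_of_nonneg_right (Real.exp_le_exp.2 ?_) ?_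
  · rw [div_eq_mul_inv]
    have : 0 ≤ V⁻¹ := inv_nonneg.2 (by linarith)
    exact mul_le_mul_of_nonneg_left (by linarith) hA0
  · refine add_nonneg (hJ0 v₀) (mul_nonneg (by positivity)
      (intervalIntegral.integral_nonneg hV fun v hv => ?_))
    have : 0 < v := by linarith [hv.1]
    positivity


theorem strictMonoOn_rstar {M : ℝ} : StrictMonoOn (rstar M) (Ioo 0 M) := by
  have hd : ∀ ρ ∈ Ioo 0 M, HasDerivAt (rstar M)
      (M ^ 2 / (M - ρ) ^ 2 - 2 * M / (M - ρ) + 1) ρ := by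
    intro ρ hρ
    have hne : M - ρ ≠ 0 := by linarith [hρ.2]
    have h1 : HasDerivAt (fun x => M - x) (-1) ρ := by simpa using (hasDerivAt_id ρ).const_sub M
    have h2 := (((hasDerivAt_const ρ (M ^ 2)).fun_div h1 hne).fun_add
      ((h1.log hne).const_mul (2 * M))).fun_add (hasDerivAt_id' ρ)
    exact h2.congr_deriv (by ring)
  refine strictMonoOn_of_deriv_pos (convex_Ioo 0 M)
    (fun ρ hρ => (hd ρ hρ).continuousAt.continuousWithinAt) fun ρ hρ => ?_
  rw [interior_Ioo] at hρ
  rw [(hd ρ hρ).deriv]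
  have hpos : 0 < M - ρ := by linarith [hρ.2]
  have hρ0 := hρ.1
  have : M ^ 2 / (M - ρ) ^ 2 - 2 * M / (M - ρ) + 1 = (ρ / (M - ρ)) ^ 2 := by
    field_simp
    ring
  rw [this]
  positivity

/-- Points of `(0, M)` where the tortoise function is at least `s > rstar M 0` stay away
from `0`. -/
theorem exists_pos_le_of_le_rstar {M s : ℝ} (hM : 0 < M) (hs : M + 2 * M * Real.log M < s) :
    ∃ δ > 0, ∀ ρ ∈ Ioo 0 M, s ≤ rstar M ρ → δ ≤ ρ := by
  have hc : ContinuousAt (rstar M) 0 := by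
    have hne : M - 0 ≠ 0 := by simpa using hM.ne'
    have h1 : ContinuousAt (fun x => M - x) 0 := by fun_prop
    exact ((continuousAt_const.div h1 hne).add (continuousAt_const.mul (h1.log hne))).add
      continuousAt_id
  have h0 : rstar M 0 < s := by
    have : rstar M 0 = M + 2 * M * Real.log M := by
      simp only [rstar, sub_zero, add_zero]
      field_simp
    rwa [this]
  obtain ⟨δ, hδ, hball⟩ := Metric.eventually_nhds_iff.1 (hc.eventually_lt_const h0)
  refine ⟨δ, hδ, fun ρ hρ hle => ?_⟩
  by_contra! hlt
  have := hball (y := ρ) (by simpa [abs_of_pos hρ.1] using hlt)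
  linarith

theorem rstar_mul_sub_le {M ρ : ℝ} (hρ : ρ ∈ Ioo 0 M) :
    rstar M ρ * (M - ρ) ≤ 2 * M ^ 2 + 2 * M ^ 3 := by
  obtain ⟨h0, h1⟩ := hρ
  have hpos : 0 < M - ρ := by linarith
  have hlog := Real.log_le_sub_one_of_pos hpos
  have heq : rstar M ρ * (M - ρ) =
      M ^ 2 + 2 * M * ((M - ρ) * Real.log (M - ρ)) + ρ * (M - ρ) := by
    simp only [rstar]
    field_simp
  have h2 : (M - ρ) * Real.log (M - ρ) ≤ M ^ 2 := by
    have := mul_le_mul_of_nonneg_left hlog hpos.le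
    nlinarith
  have h3 := mul_le_mul_of_nonneg_left h2 (by linarith : 0 ≤ 2 * M)
  nlinarith

/-- Quadratic decay of `Ω² / r` in terms of the tortoise function. -/
theorem exists_sq_div_le_inv_rstar_sq {M s : ℝ} (hM : 0 < M)
    (hs : M + 2 * M * Real.log M < s) (hs0 : 0 < s) :
    ∃ k ≥ 0, ∀ ρ ∈ Ioo 0 M, s ≤ rstar M ρ →
      (1 - M / ρ) ^ 2 / ρ ≤ k * (rstar M ρ ^ 2)⁻¹ := by
  obtain ⟨δ, hδ, hle⟩ := exists_pos_le_of_le_rstar hM hs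
  refine ⟨(2 * M ^ 2 + 2 * M ^ 3) ^ 2 / δ ^ 3, by positivity, fun ρ hρ hsρ => ?_⟩
  have hδρ := hle ρ hρ hsρ
  have hρ0 : 0 < ρ := hρ.1
  have hr : 0 < rstar M ρ := hs0.trans_le hsρ
  have hsub : 0 < M - ρ := by linarith [hρ.2]
  have h1 : (1 - M / ρ) ^ 2 / ρ = (rstar M ρ * (M - ρ)) ^ 2 / ρ ^ 3 * (rstar M ρ ^ 2)⁻¹ := by
    field_simp
    ring
  rw [h1]
  gcongr
  exact rstar_mul_sub_le hρ

namespace WaveSetup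

variable {M u₀ v₀ : ℝ}

theorem continuousOn_r (W : WaveSetup M u₀ v₀) :
    ContinuousOn (fun x : ℝ × ℝ => W.r x.1 x.2)
      {x | M + 2 * M * Real.log M < x.2 - x.1} := by
  intro x hx
  have hmono := strictMonoOn_rstar (M := M)
  have hmem := W.hr_mem x.1 x.2 hx
  have hstar := W.hr_star x.1 x.2 hx
  have hc : Tendsto (fun y : ℝ × ℝ => y.2 - y.1)
      (𝓝[{x | M + 2 * M * Real.log M < x.2 - x.1}] x) (𝓝 (x.2 - x.1)) :=
    (by fun_prop : Continuous fun y : ℝ × ℝ => y.2 - y.1).continuousWithinAt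
  refine tendsto_order.2 ⟨fun a ha => ?_, fun b hb => ?_⟩
  · rcases le_or_gt a 0 with ha0 | ha0
    · filter_upwards [self_mem_nhdsWithin] with y hy
      exact ha0.trans_lt (W.hr_mem y.1 y.2 hy).1
    · have hamem : a ∈ Ioo 0 M := ⟨ha0, ha.trans hmem.2⟩
      have hlt := hmono hamem hmem ha
      rw [hstar] at hlt
      filter_upwards [self_mem_nhdsWithin, hc.eventually_const_lt hlt] with y hy hya
      rw [← W.hr_star y.1 y.2 hy] at hya
      exact (hmono.lt_iff_lt hamem (W.hr_mem y.1 y.2 hy)).1 hya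
  · rcases le_or_gt M b with hbM | hbM
    · filter_upwards [self_mem_nhdsWithin] with y hy
      exact (W.hr_mem y.1 y.2 hy).2.trans_le hbM
    · have hbmem : b ∈ Ioo 0 M := ⟨hmem.1.trans hb, hbM⟩
      have hlt := hmono hmem hbmem hb
      rw [hstar] at hlt
      filter_upwards [self_mem_nhdsWithin, hc.eventually_lt_const hlt] with y hy hya
      rw [← W.hr_star y.1 y.2 hy] at hya
      exact (hmono.lt_iff_lt (W.hr_mem y.1 y.2 hy) hbmem).1 hya

theorem φuv_eq (W : WaveSetup M u₀ v₀) {u v : ℝ} (hu : u ≤ u₀) (hv : v₀ ≤ v) :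
    W.φuv u v = W.Ω2 u v / W.r u v * (W.φv u v - W.φu u v) := by
  have hr := (W.hr_mem u v (by linarith [W.hdom])).1
  have := W.hwave u hu v hv
  simp only [Ω2]
  rw [div_mul_eq_mul_div, eq_div_iff hr.ne']
  linarith

theorem continuous_clamp {g : ℝ → ℝ → ℝ}
    (hg : ContinuousOn (fun x : ℝ × ℝ => g x.1 x.2) (Iic u₀ ×ˢ Ici v₀)) :
    Continuous fun x : ℝ × ℝ => g (min x.1 u₀) (max x.2 v₀) :=
  hg.comp_continuous (by fun_prop : Continuous fun x : ℝ × ℝ => (min x.1 u₀, max x.2 v₀))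
    fun _ => ⟨mem_Iic.2 (min_le_right _ _), mem_Ici.2 (le_max_right _ _)⟩

theorem continuousOn_Ω2_div_r (W : WaveSetup M u₀ v₀) :
    ContinuousOn (fun x : ℝ × ℝ => W.Ω2 x.1 x.2 / W.r x.1 x.2) (Iic u₀ ×ˢ Ici v₀) := by
  have hsub : Iic u₀ ×ˢ Ici v₀ ⊆ {x : ℝ × ℝ | M + 2 * M * Real.log M < x.2 - x.1} := by
    rintro ⟨u, v⟩ ⟨hu, hv⟩
    simp only [mem_Iic, mem_Ici, mem_ofPred_eq] at hu hv ⊢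
    linarith [W.hdom]
  have hr := W.continuousOn_r.mono hsub
  have hne : ∀ x ∈ Iic u₀ ×ˢ Ici v₀, W.r x.1 x.2 ≠ 0 := fun x hx =>
    (W.hr_mem x.1 x.2 (hsub hx)).1.ne'
  exact ((continuousOn_const.sub (continuousOn_const.div hr hne)).pow 2).div hr hne

theorem φ_sub_eq_integral (W : WaveSetup M u₀ v₀) {U u v : ℝ} (hUu : U ≤ u) (hu : u ≤ u₀)
    (hv : v₀ ≤ v) :
    W.φ u v - W.φ U v = ∫ w in U..u, W.φu (min w u₀) (max v v₀) := by
  have hc := continuous_clamp W.hφu_cont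
  symm
  refine intervalIntegral.integral_eq_sub_of_hasDerivAt_of_le (f := fun w => W.φ w v) hUu ?_ ?_
    ((hc.comp (by fun_prop : Continuous fun w => (w, v))).intervalIntegrable _ _)
  · exact fun w hw => ((W.hφu w (hw.2.trans hu) v hv).continuousWithinAt).mono
      fun x hx => hx.2.trans hu
  · intro w hw
    have hwu : w < u₀ := hw.2.trans_le hu
    rw [min_eq_left hwu.le, max_eq_left hv]
    exact (W.hφu w hwu.le v hv).hasDerivAt (Iic_mem_nhds hwu)

theorem φu_eq_add_integral (W : WaveSetup M u₀ v₀) {u v : ℝ} (hu : u ≤ u₀) (hv : v₀ ≤ v) :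
    W.φu u v = W.φu u v₀ + ∫ w in v₀..v,
      W.Ω2 (min u u₀) (max w v₀) / W.r (min u u₀) (max w v₀) *
        (W.φv (min u u₀) (max w v₀) - W.φu (min u u₀) (max w v₀)) := by
  have hp := continuous_clamp W.hφu_cont
  have hs := continuous_clamp W.hφv_cont
  have hK := continuous_clamp (g := fun u v => W.Ω2 u v / W.r u v) W.continuousOn_Ω2_div_r
  rw [intervalIntegral.integral_eq_sub_of_hasDerivAt_of_le (f := fun w => W.φu u w) hv]
  · ring
  · exact fun w hw => ((W.hφuv u hu w hw.1).continuousWithinAt).mono fun x hx => hx.1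
  · intro w hw
    rw [min_eq_left hu, max_eq_left hw.1.le, ← W.φuv_eq hu hw.1.le]
    exact (W.hφuv u hu w hw.1.le).hasDerivAt (Ici_mem_nhds hw.1)
  · exact ((hK.mul (hs.sub hp)).comp
      (by fun_prop : Continuous fun w => (u, w))).intervalIntegrable _ _

theorem φv_eq_add_integral (W : WaveSetup M u₀ v₀) {U u v : ℝ} (hUu : U ≤ u) (hu : u ≤ u₀)
    (hv : v₀ ≤ v) :
    W.φv u v = W.φv U v + ∫ w in U..u,
      W.Ω2 (min w u₀) (max v v₀) / W.r (min w u₀) (max v v₀) *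
        (W.φv (min w u₀) (max v v₀) - W.φu (min w u₀) (max v v₀)) := by
  have hp := continuous_clamp W.hφu_cont
  have hs := continuous_clamp W.hφv_cont
  have hK := continuous_clamp (g := fun u v => W.Ω2 u v / W.r u v) W.continuousOn_Ω2_div_r
  set G : ℝ → ℝ → ℝ := fun w v => W.Ω2 (min w u₀) (max v v₀) / W.r (min w u₀) (max v v₀) *
    (W.φv (min w u₀) (max v v₀) - W.φu (min w u₀) (max v v₀)) with hG
  have hGc : Continuous fun x : ℝ × ℝ => G x.1 x.2 := hK.mul (hs.sub hp)
  have hHc : Continuous fun v => ∫ w in U..u, G w v :=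
    intervalIntegral.continuous_parametric_intervalIntegral_of_continuous' (f := fun v w => G w v)
      (hGc.comp continuous_swap) U u
  have hp₀ : Continuous fun w => W.φu (min w u₀) (max v₀ v₀) :=
    hp.comp (by fun_prop : Continuous fun w => (w, v₀))
  have hdiff : ∀ x ∈ Ici v₀, W.φ u x - W.φ U x =
      (W.φ u v₀ - W.φ U v₀) + ∫ y in v₀..x, ∫ w in U..u, G w y := by
    intro x hx
    rw [W.φ_sub_eq_integral hUu hu hx, W.φ_sub_eq_integral hUu hu le_rfl,
      ← integral_integral_swap_of_continuous hGc, ← intervalIntegral.integral_add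
        (hp₀.intervalIntegrable _ _)
        ((intervalIntegral.continuous_parametric_intervalIntegral_of_continuous'
          (f := G) hGc v₀ x).intervalIntegrable _ _)]
    refine intervalIntegral.integral_congr fun w hw => ?_
    rw [uIcc_of_le hUu] at hw
    have hwu : w ≤ u₀ := hw.2.trans hu
    simp only [hG]
    rw [max_eq_left (mem_Ici.1 hx), max_self, min_eq_left hwu, W.φu_eq_add_integral hwu hx,
      min_eq_left hwu]
  have h1 : HasDerivWithinAt (fun x => W.φ u x - W.φ U x) (W.φv u v - W.φv U v) (Ici v₀) v :=
    (W.hφv u hu v hv).sub (W.hφv U (hUu.trans hu) v hv)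
  have h2 : HasDerivWithinAt (fun x => W.φ u x - W.φ U x) (∫ w in U..u, G w v) (Ici v₀) v :=
    ((hHc.integral_hasStrictDerivAt v₀ v).hasDerivAt.const_add _).hasDerivWithinAt.congr
      hdiff (hdiff v hv)
  have := (uniqueDiffOn_Ici v₀ v hv).eq_deriv _ h1 h2
  linarith

/-- The wave is controlled by its data on the characteristic segments `[U, u₀] × {v₀}` and
`{U} × [v₀, v]`, with constants independent of the truncation `U`. -/
theorem abs_φ_le_of_truncation (W : WaveSetup M u₀ v₀) {k U u v : ℝ} (hk : 0 ≤ k)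
    (hkle : ∀ ρ ∈ Ioo 0 M, v₀ - u₀ ≤ rstar M ρ →
      (1 - M / ρ) ^ 2 / ρ ≤ k * (rstar M ρ ^ 2)⁻¹)
    (hUu : U ≤ u) (hu : u ≤ u₀) (hv : v₀ ≤ v) :
    |W.φ u v| ≤ |W.φ U v| + Real.exp ((k + k ^ 2 * Real.exp (k / v₀) / v₀) / v₀) *
      ((∫ w in U..u₀, |W.φu w v₀|) +
        k * Real.exp (k / v₀) * ∫ y in v₀..v, y⁻¹ * |W.φv U y|) := by
  have hp := continuous_clamp W.hφu_cont
  have hs := continuous_clamp W.hφv_cont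
  have hK := continuous_clamp (g := fun u v => W.Ω2 u v / W.r u v) W.continuousOn_Ω2_div_r
  have hUu₀ := hUu.trans hu
  have key := integral_abs_le_of_characteristic_system (V := v)
    (p := fun u v => W.φu (min u u₀) (max v v₀)) (s := fun u v => W.φv (min u u₀) (max v v₀))
    (K := fun u v => W.Ω2 (min u u₀) (max v v₀) / W.r (min u u₀) (max v v₀))
    hp hs hK hk W.hu₀ W.hv₀ hUu₀ hv
    (fun u hu v hv => by
      have := (W.hr_mem u v (by linarith [W.hdom])).1
      rw [min_eq_left hu, max_eq_left hv, Ω2]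
      positivity)
    (fun u hu v hv => by
      have hd : M + 2 * M * Real.log M < v - u := by linarith [W.hdom]
      rw [min_eq_left hu, max_eq_left hv, Ω2, ← W.hr_star u v hd]
      exact hkle _ (W.hr_mem u v hd) (by rw [W.hr_star u v hd]; linarith))
    (fun u hu v hv => by
      simpa only [min_eq_left hu, max_eq_left hv, max_self] using W.φu_eq_add_integral hu hv)
    (fun u hUu hu v hv => by
      simpa only [min_eq_left hu, min_eq_left hUu₀, max_eq_left hv] using
        W.φv_eq_add_integral hUu hu hv)
  have e1 : ∫ w in U..u₀, |W.φu (min w u₀) (max v₀ v₀)| = ∫ w in U..u₀, |W.φu w v₀| := by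
    refine intervalIntegral.integral_congr fun w hw => ?_
    rw [uIcc_of_le hUu₀] at hw
    simp only [min_eq_left hw.2, max_self]
  have e2 : ∫ y in v₀..v, y⁻¹ * |W.φv (min U u₀) (max y v₀)| =
      ∫ y in v₀..v, y⁻¹ * |W.φv U y| := by
    refine intervalIntegral.integral_congr fun y hy => ?_
    rw [uIcc_of_le hv] at hy
    simp only [max_eq_left hy.1, min_eq_left hUu₀]
  rw [e1, e2] at key
  have hpu : Continuous fun w => |W.φu (min w u₀) (max v v₀)| :=
    (hp.comp (by fun_prop : Continuous fun w => (w, v))).abs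
  have hsub := W.φ_sub_eq_integral hUu hu hv
  calc |W.φ u v| = |W.φ U v + ∫ w in U..u, W.φu (min w u₀) (max v v₀)| := by
        rw [← hsub]; ring_nf
    _ ≤ |W.φ U v| + |∫ w in U..u, W.φu (min w u₀) (max v v₀)| := abs_add_le _ _
    _ ≤ |W.φ U v| + ∫ w in U..u, |W.φu (min w u₀) (max v v₀)| :=
        add_le_add_right (intervalIntegral.abs_integral_le_integral_abs hUu) _
    _ ≤ |W.φ U v| + ∫ w in U..u₀, |W.φu (min w u₀) (max v v₀)| :=
        add_le_add_right (intervalIntegral.integral_mono_interval le_rfl hUu hu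
          (Filter.Eventually.of_forall fun w => abs_nonneg _) (hpu.intervalIntegrable _ _)) _
    _ ≤ _ := add_le_add_right key _

end WaveSetup

/-- Asymptotically as `U → -∞`, the weighted flux of `∂_v φ` through `{U} × [v₀, v]` is bounded
by the weighted flux through the horizon. -/
theorem WaveSetupH.eventually_integral_inv_mul_abs_φv_le {M u₀ v₀ q v ε : ℝ}
    (W : WaveSetupH M u₀ v₀) (hq : q < 1) (hv : v₀ ≤ v) (hε : 0 < ε)
    (hint : IntegrableOn (fun y => y ^ (-q) * |W.φH' y|) (Ioi v₀)) :
    ∀ᶠ U in atBot, ∫ y in v₀..v, y⁻¹ * |W.φv U y| ≤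
      v₀ ^ (q - 1) * (∫ y in Ioi v₀, y ^ (-q) * |W.φH' y|) + (v - v₀) * (v₀⁻¹ * ε) := by
  have hv₀ := W.hv₀
  have hunif : TendstoUniformlyOn (fun U y => W.φv U y) W.φH' atBot (Icc v₀ v) :=
    (tendstoLocallyUniformlyOn_iff_tendstoUniformlyOn_of_compact isCompact_Icc).1
      (W.hφH'_tendsto.mono Icc_subset_Ici_self)
  have hintv : IntervalIntegrable (fun y => y ^ (-q) * |W.φH' y|) volume v₀ v :=
    (intervalIntegrable_iff_integrableOn_Ioc_of_le hv).2 (hint.mono_set Ioc_subset_Ioi_self)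
  filter_upwards [Metric.tendstoUniformlyOn_iff.1 hunif ε hε, eventually_le_atBot u₀]
    with U hU hUu
  have hc : ContinuousOn (fun y => y⁻¹ * |W.φv U y|) (Icc v₀ v) := by
    refine ContinuousOn.mul (continuousOn_id.inv₀ fun y hy => (hv₀.trans_le hy.1).ne') ?_
    exact (W.hφv_cont.comp (by fun_prop : ContinuousOn (fun y => (U, y)) (Icc v₀ v))
      fun y hy => ⟨hUu, hy.1⟩).abs
  calc ∫ y in v₀..v, y⁻¹ * |W.φv U y|
      ≤ ∫ y in v₀..v, (v₀ ^ (q - 1) * (y ^ (-q) * |W.φH' y|) + v₀⁻¹ * ε) := by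
        refine intervalIntegral.integral_mono_on hv
          (ContinuousOn.intervalIntegrable (by rwa [uIcc_of_le hv]))
          ((hintv.const_mul _).add intervalIntegrable_const) fun y hy => ?_
        have hy0 : 0 < y := hv₀.trans_le hy.1
        have hd := hU y hy
        rw [Real.dist_eq] at hd
        have habs : |W.φv U y| ≤ |W.φH' y| + ε := by
          have := abs_sub_abs_le_abs_sub (W.φv U y) (W.φH' y)
          rw [abs_sub_comm] at this
          linarith
        have hpow : y⁻¹ ≤ v₀ ^ (q - 1) * y ^ (-q) := by
          have h1 : y⁻¹ = y ^ (q - 1) * y ^ (-q) := by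
            rw [← Real.rpow_add hy0, ← Real.rpow_neg_one]
            ring_nf
          rw [h1]
          exact mul_le_mul_of_nonneg_right
            (Real.rpow_le_rpow_of_nonpos hv₀ hy.1 (by linarith)) (Real.rpow_nonneg hy0.le _)
        have hinv : y⁻¹ ≤ v₀⁻¹ := inv_anti₀ hv₀ hy.1
        calc y⁻¹ * |W.φv U y| ≤ y⁻¹ * (|W.φH' y| + ε) := by gcongr
          _ = y⁻¹ * |W.φH' y| + y⁻¹ * ε := by ring
          _ ≤ v₀ ^ (q - 1) * y ^ (-q) * |W.φH' y| + v₀⁻¹ * ε := by gcongr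
          _ = _ := by ring
    _ = v₀ ^ (q - 1) * (∫ y in v₀..v, y ^ (-q) * |W.φH' y|) + (v - v₀) * (v₀⁻¹ * ε) := by
        rw [intervalIntegral.integral_add (hintv.const_mul _) intervalIntegrable_const,
          intervalIntegral.integral_const_mul, intervalIntegral.integral_const, smul_eq_mul]
    _ ≤ _ := by
        rw [intervalIntegral.integral_of_le hv]
        refine add_le_add_left (mul_le_mul_of_nonneg_left ?_ (Real.rpow_nonneg hv₀.le _)) _
        refine setIntegral_mono_set hint ?_ Ioc_subset_Ioi_self.eventuallyLE
        refine (ae_restrict_iff' measurableSet_Ioi).2 (Filter.Eventually.of_forall fun y hy => ?_)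
        exact mul_nonneg (Real.rpow_nonneg (hv₀.trans hy).le _) (abs_nonneg _)

/-- **Uniform pointwise boundedness of `φ₀`** (Proposition 4.3): with
`F_q[φ] = ∫_{-∞}^{u₀} |∂_u φ|(u',v₀) du' + ∫_{v₀}^{∞} v'^{-q} |φ_H'(v')| dv' < ∞`,
there is a constant `C = C(M,u₀,v₀,q) > 0`, independent of `φ`, with
`|φ(u,v)| ≤ |φ_H(v)| + C F_q[φ]` on `D`. -/
theorem pointwise_bound_φ (M u₀ v₀ q : ℝ) (hq₁ : -1 < q) (hq₂ : q < 1) :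
    ∃ C > (0:ℝ), ∀ W : WaveSetupH M u₀ v₀,
      IntegrableOn (fun u' => |W.φu u' v₀|) (Set.Iic u₀) →
      IntegrableOn (fun v' => v' ^ (-q) * |W.φH' v'|) (Set.Ioi v₀) →
      ∀ u ≤ u₀, ∀ v : ℝ, v₀ ≤ v →
        |W.φ u v| ≤ |W.φH v| +
          C * ((∫ u' in Set.Iic u₀, |W.φu u' v₀|) +
            ∫ v' in Set.Ioi v₀, v' ^ (-q) * |W.φH' v'|) := by
  rcases isEmpty_or_nonempty (WaveSetupH M u₀ v₀) with hemp | ⟨⟨W₀⟩⟩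
  · exact ⟨1, one_pos, fun W => (hemp.false W).elim⟩
  have hv₀ := W₀.hv₀
  obtain ⟨k, hk, hkle⟩ := exists_sq_div_le_inv_rstar_sq W₀.hM W₀.hdom
    (by linarith [W₀.hu₀, W₀.hv₀])
  set E := Real.exp ((k + k ^ 2 * Real.exp (k / v₀) / v₀) / v₀) with hE
  set B := k * Real.exp (k / v₀) with hB
  have hB0 : 0 ≤ B := by positivity
  have hE0 : 0 < E := Real.exp_pos _
  have hP0 : 0 ≤ v₀ ^ (q - 1) := Real.rpow_nonneg hv₀.le _
  refine ⟨E * (1 + B * v₀ ^ (q - 1)), by positivity, fun W hint₁ hint₂ u hu v hv => ?_⟩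
  set F₁ := ∫ u' in Set.Iic u₀, |W.φu u' v₀| with hF₁
  set F₂ := ∫ v' in Set.Ioi v₀, v' ^ (-q) * |W.φH' v'| with hF₂
  have hF₁0 : 0 ≤ F₁ := setIntegral_nonneg measurableSet_Iic fun _ _ => abs_nonneg _
  have hF₂0 : 0 ≤ F₂ := setIntegral_nonneg measurableSet_Ioi fun y hy =>
    mul_nonneg (Real.rpow_nonneg (hv₀.trans hy).le _) (abs_nonneg _)
  have hlim : Tendsto (fun U => |W.φ U v|) atBot (𝓝 |W.φH v|) :=
    (W.hφH_tendsto.tendsto_at (mem_Ici.2 hv)).abs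
  have hle : ∀ ε > 0, |W.φ u v| ≤ |W.φH v| +
      E * (F₁ + B * (v₀ ^ (q - 1) * F₂ + (v - v₀) * (v₀⁻¹ * ε))) := by
    intro ε hε
    refine ge_of_tendsto (hlim.add_const _) ?_
    filter_upwards [W.eventually_integral_inv_mul_abs_φv_le hq₂ hv hε hint₂,
      eventually_le_atBot u] with U hU hUu
    refine (W.abs_φ_le_of_truncation hk hkle hUu hu hv).trans ?_
    have h1 : ∫ w in U..u₀, |W.φu w v₀| ≤ F₁ := by
      rw [intervalIntegral.integral_of_le (hUu.trans hu)]
      exact setIntegral_mono_set hint₁ (Filter.Eventually.of_forall fun _ => abs_nonneg _)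
        Ioc_subset_Iic_self.eventuallyLE
    gcongr
  have hcont : Continuous fun ε : ℝ => |W.φH v| +
      E * (F₁ + B * (v₀ ^ (q - 1) * F₂ + (v - v₀) * (v₀⁻¹ * ε))) := by fun_prop
  have hlim0 := ge_of_tendsto (hcont.tendsto 0 |>.mono_left nhdsWithin_le_nhds)
    (eventually_mem_nhdsWithin.mono hle : ∀ᶠ ε in 𝓝[>] (0 : ℝ), _)
  refine hlim0.trans (add_le_add_right ?_ _)
  rw [mul_assoc E]
  refine mul_le_mul_of_nonneg_left ?_ hE0.le
  have h1 : 0 ≤ B * v₀ ^ (q - 1) * F₁ := by positivity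
  linarith
end
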